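/- Let $0 < y \le 1$, $a = (1-\sqrt{y})^2$, $b = (1+\sqrt{y})^2$. For $z$ in the upper half plane, the Stieltjes transform of the Marchenko–Pastur law, $s_{MP,y}(z) = \int_a^b \frac{\rho_{MP,y}(x)}{x - z}\,dx$, satisfies the self-consistent equation $s_{MP,y}(z) + \frac{1}{y + z - 1 + y z \, s_{MP,y}(z)} = 0$. -/

import Mathlib

/-- The Marchenko–Pastur density with ratio parameter `y`. -/
noncomputable def mpDensity (y x : ℝ) : ℝ :=
  (1 / (2 * Real.pi * x * y)) *
    Real.sqrt (((1 + Real.sqrt y) ^ 2 - x) * (x - (1 - Real.sqrt y) ^ 2))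

/-- The Stieltjes transform of the Marchenko–Pastur law with ratio parameter `y`. -/
noncomputable def mpStieltjes (y : ℝ) (z : ℂ) : ℂ :=
  ∫ x in ((1 - Real.sqrt y) ^ 2)..((1 + Real.sqrt y) ^ 2),
    (mpDensity y x : ℂ) / ((x : ℂ) - z)

open Real MeasureTheory in
/-- The Cauchy integral formula evaluates the Chebyshev moment of the Poisson-type kernel. -/
lemma integral_sin_sq_div_kernel {w : ℂ} (hw : ‖w‖ < 1) :
    ∫ θ in (0 : ℝ)..π, (sin θ : ℂ) ^ 2 / (1 - 2 * w * (cos θ : ℂ) + w ^ 2) = (π : ℂ) / 2 := by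
  have hne : ∀ ζ : ℂ, ‖ζ‖ ≤ 1 → 1 - w * ζ ≠ 0 := fun ζ hζ h => by
    have h1 : ‖w * ζ‖ = 1 := by rw [← sub_eq_zero.mp h, norm_one]
    rw [norm_mul] at h1
    nlinarith [norm_nonneg ζ, norm_nonneg w]
  have hcauchy := DifferentiableOn.circleIntegral_sub_inv_smul (c := 0) (R := 1) (w := w)
    (f := fun ζ : ℂ => (1 - ζ ^ 2) / (2 * (1 - w * ζ)))
    (fun ζ hζ => by
      have h := hne ζ (by simpa using hζ)
      apply DifferentiableAt.differentiableWithinAt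
      fun_prop (disch := simpa using h)) (by simpa using hw)
  set g : ℝ → ℂ := fun θ =>
    (1 - Complex.exp (θ * Complex.I) ^ 2) * Complex.exp (θ * Complex.I) /
      (2 * (1 - w * Complex.exp (θ * Complex.I)) * (Complex.exp (θ * Complex.I) - w)) with hg
  have hne' : ∀ θ : ℝ, Complex.exp (θ * Complex.I) - w ≠ 0 := fun θ h => by
    have := congrArg norm (sub_eq_zero.mp h)
    rw [Complex.norm_exp_ofReal_mul_I] at this
    linarith
  have hne'' : ∀ θ : ℝ, 1 - w * Complex.exp (θ * Complex.I) ≠ 0 := fun θ =>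
    hne _ (Complex.norm_exp_ofReal_mul_I θ).le
  have hgcont : Continuous g := by
    refine Continuous.div (by fun_prop) (by fun_prop) fun θ => ?_
    exact mul_ne_zero (mul_ne_zero two_ne_zero (hne'' θ)) (hne' θ)
  have hg_int : ∫ θ in (0 : ℝ)..2 * π, g θ = π := by
    have h : (∮ ζ in C(0, 1), (ζ - w)⁻¹ • ((1 - ζ ^ 2) / (2 * (1 - w * ζ)))) =
        Complex.I * ∫ θ in (0 : ℝ)..2 * π, g θ := by
      rw [circleIntegral, ← intervalIntegral.integral_const_mul]
      refine intervalIntegral.integral_congr fun θ _ => ?_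
      simp only [deriv_circleMap, circleMap, hg, smul_eq_mul, Complex.ofReal_one, zero_add,
        one_mul]
      field_simp [hne' θ, hne'' θ]
    rw [h, smul_eq_mul] at hcauchy
    have hw' : 1 - w ^ 2 ≠ 0 := by simpa [sq] using hne w hw.le
    have hval : (2 * π * Complex.I) * ((1 - w ^ 2) / (2 * (1 - w * w))) = Complex.I * π := by
      rw [← sq]
      field_simp
    rw [hval] at hcauchy
    exact mul_left_cancel₀ Complex.I_ne_zero hcauchy
  have hfold : ∫ θ in (0 : ℝ)..2 * π, g θ = ∫ θ in (0 : ℝ)..π, (g θ + g (2 * π - θ)) := by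
    rw [← intervalIntegral.integral_add_adjacent_intervals (b := π)
      (hgcont.intervalIntegrable _ _) (hgcont.intervalIntegrable _ _),
      intervalIntegral.integral_add (hgcont.intervalIntegrable _ _)
      ((show Continuous fun θ => g (2 * π - θ) by fun_prop).intervalIntegrable _ _),
      intervalIntegral.integral_comp_sub_left]
    congr 2 <;> ring
  have hsum : ∀ θ : ℝ, g θ + g (2 * π - θ) =
      2 * ((sin θ : ℂ) ^ 2 / (1 - 2 * w * (cos θ : ℂ) + w ^ 2)) := fun θ => by
    have hinv : Complex.exp (((2 * π - θ : ℝ) : ℂ) * Complex.I) =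
        (Complex.exp (θ * Complex.I))⁻¹ := by
      rw [← Complex.exp_neg]
      push_cast
      rw [sub_mul, sub_eq_add_neg, Complex.exp_add, Complex.exp_two_pi_mul_I, one_mul]
    have h1 := hne' θ
    have h2 := hne'' θ
    have h3 := hne' (2 * π - θ)
    have h4 := hne'' (2 * π - θ)
    have hz : Complex.exp (θ * Complex.I) ≠ 0 := Complex.exp_ne_zero _
    have hcos : (cos θ : ℂ) = (Complex.exp (θ * Complex.I) +
        (Complex.exp (θ * Complex.I))⁻¹) / 2 := by
      rw [Complex.ofReal_cos, Complex.cos, neg_mul, Complex.exp_neg]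
    have hsin : (sin θ : ℂ) ^ 2 = 1 - ((Complex.exp (θ * Complex.I) +
        (Complex.exp (θ * Complex.I))⁻¹) / 2) ^ 2 := by
      rw [← hcos, ← Complex.ofReal_pow, ← Complex.ofReal_pow, sin_sq]
      push_cast
      rfl
    simp only [hg]
    rw [hinv] at h3 h4 ⊢
    rw [hsin, hcos]
    generalize Complex.exp (θ * Complex.I) = ζ at *
    have e : 1 - 2 * w * ((ζ + ζ⁻¹) / 2) + w ^ 2 = (1 - w * ζ) * (ζ - w) / ζ := by
      field_simp
      ring
    have e3 : ζ⁻¹ - w = (1 - w * ζ) / ζ := by field_simp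
    have e4 : 1 - w * ζ⁻¹ = (ζ - w) / ζ := by field_simp
    rw [e, e3, e4]
    field_simp
    ring
  rw [hfold] at hg_int
  simp only [hsum] at hg_int
  rw [intervalIntegral.integral_const_mul] at hg_int
  rw [← hg_int]
  ring

/-- The inverse Joukowski map at a non-real point. -/
lemma exists_norm_lt_one_add_inv_eq {u : ℂ} (hu : u.im ≠ 0) :
    ∃ w : ℂ, w ≠ 0 ∧ ‖w‖ < 1 ∧ w + w⁻¹ = u := by
  obtain ⟨s, hs⟩ := IsAlgClosed.exists_pow_nat_eq (u ^ 2 - 4) (n := 2) two_pos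
  have hprod : (u + s) / 2 * ((u - s) / 2) = 1 := by linear_combination -hs / 4
  have hne : (u + s) / 2 ≠ 0 := left_ne_zero_of_mul_eq_one hprod
  have hinv : (u - s) / 2 = ((u + s) / 2)⁻¹ := eq_inv_of_mul_eq_one_right hprod
  have hsum : (u + s) / 2 + ((u + s) / 2)⁻¹ = u := by rw [← hinv]; ring
  generalize (u + s) / 2 = w at hne hsum
  rcases lt_trichotomy ‖w‖ 1 with h | h | h
  · exact ⟨w, hne, h, hsum⟩
  · refine absurd ?_ hu
    rw [← hsum, Complex.inv_eq_conj h]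
    simp
  · refine ⟨w⁻¹, inv_ne_zero hne, ?_, by rw [inv_inv, add_comm, hsum]⟩
    rw [norm_inv]
    exact inv_lt_one_of_one_lt₀ h

open Real MeasureTheory in
lemma integral_sin_sq_div_one_add_sq {q : ℝ} (hq0 : 0 < q) (hq1 : q ≤ 1) :
    ∫ θ in (0 : ℝ)..π, (sin θ : ℂ) ^ 2 / (1 + 2 * q * (cos θ : ℂ) + q ^ 2) = (π : ℂ) / 2 := by
  rcases hq1.lt_or_eq with h | rfl
  · have := integral_sin_sq_div_kernel (w := -(q : ℂ))
      (by simpa [abs_of_pos hq0] using h)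
    simpa using this
  · have hcongr : ∫ θ in (0 : ℝ)..π,
        (sin θ : ℂ) ^ 2 / (1 + 2 * ((1 : ℝ) : ℂ) * (cos θ : ℂ) + ((1 : ℝ) : ℂ) ^ 2) =
        ∫ θ in (0 : ℝ)..π, (((1 - cos θ) / 2 : ℝ) : ℂ) := by
      refine intervalIntegral.integral_congr_ae ?_
      filter_upwards [Measure.ae_ne volume π] with θ hθ hmem
      rw [Set.uIoc_of_le pi_pos.le] at hmem
      have hcos : -1 < cos θ := by
        rw [← cos_pi]
        exact cos_lt_cos_of_nonneg_of_le_pi hmem.1.le le_rfl (lt_of_le_of_ne hmem.2 hθ)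
      have h : 1 + 2 * 1 * cos θ + 1 ^ 2 ≠ 0 := by linarith
      have hreal : sin θ ^ 2 / (1 + 2 * 1 * cos θ + 1 ^ 2) = (1 - cos θ) / 2 := by
        rw [div_eq_div_iff h two_ne_zero, sin_sq]
        ring
      rw [← hreal]
      push_cast
      rfl
    rw [hcongr, intervalIntegral.integral_ofReal, intervalIntegral.integral_div,
      intervalIntegral.integral_sub (by simp) (continuous_cos.intervalIntegrable _ _)]
    simp

open Real MeasureTheory in
/-- The substitution `x = 1 + y + 2 √y cos θ` in the Stieltjes transform. -/
lemma mpStieltjes_eq_integral_sin_sq {y : ℝ} (hy0 : 0 < y) (z : ℂ) :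
    mpStieltjes y z = ∫ θ in (0 : ℝ)..π, 2 / π *
      ((sin θ : ℂ) ^ 2 / ((1 + 2 * √y * (cos θ : ℂ) + (√y : ℂ) ^ 2) *
        (1 + 2 * √y * (cos θ : ℂ) + (√y : ℂ) ^ 2 - z))) := by
  have hq0 : 0 < √y := sqrt_pos.mpr hy0
  have hqy : y = √y ^ 2 := (sq_sqrt hy0.le).symm
  rw [mpStieltjes]
  unfold mpDensity
  set q := √y
  rw [hqy]
  set φ : ℝ → ℝ := fun θ => 1 + 2 * q * cos θ + q ^ 2 with hφ
  have himage : φ '' Set.Icc 0 π = Set.Icc ((1 - q) ^ 2) ((1 + q) ^ 2) := by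
    ext x
    constructor
    · rintro ⟨θ, -, rfl⟩
      constructor <;> simp only [hφ] <;> nlinarith [neg_one_le_cos θ, cos_le_one θ]
    · rintro ⟨h1, h2⟩
      refine ⟨arccos ((x - 1 - q ^ 2) / (2 * q)), ⟨arccos_nonneg _, arccos_le_pi _⟩, ?_⟩
      simp only [hφ]
      rw [cos_arccos]
      · field_simp
        ring
      · rw [le_div_iff₀ (by positivity)]
        linarith
      · rw [div_le_iff₀ (by positivity)]
        linarith
  have hinj : Set.InjOn φ (Set.Icc 0 π) := fun s hs t ht h => by
    refine injOn_cos hs ht ?_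
    have : 2 * q * (cos s - cos t) = 0 := by
      simp only [hφ] at h
      linarith
    rcases mul_eq_zero.mp this with h | h
    · linarith
    · linarith
  have hderiv : ∀ θ ∈ Set.Icc 0 π,
      HasDerivWithinAt φ (2 * q * -sin θ) (Set.Icc 0 π) θ := fun θ _ =>
    ((((hasDerivAt_cos θ).const_mul (2 * q)).const_add 1).add_const _).hasDerivWithinAt
  rw [intervalIntegral.integral_of_le (by nlinarith), ← integral_Icc_eq_integral_Ioc, ← himage,
    integral_image_eq_integral_abs_deriv_smul measurableSet_Icc hderiv hinj,
    intervalIntegral.integral_of_le pi_pos.le, ← integral_Icc_eq_integral_Ioc]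
  refine setIntegral_congr_fun measurableSet_Icc fun θ hθ => ?_
  have hsin : 0 ≤ sin θ := sin_nonneg_of_mem_Icc hθ
  have habs : |2 * q * -sin θ| = 2 * q * sin θ := by
    rw [mul_neg, abs_neg, abs_of_nonneg (by positivity)]
  have hsqrt : √(((1 + q) ^ 2 - φ θ) * (φ θ - (1 - q) ^ 2)) = 2 * q * sin θ := by
    rw [← sqrt_sq (show 0 ≤ 2 * q * sin θ by positivity)]
    congr 1
    simp only [hφ, mul_pow, sin_sq]
    ring
  have hcast : (φ θ : ℂ) = 1 + 2 * q * (cos θ : ℂ) + (q : ℂ) ^ 2 := by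
    simp only [hφ]
    push_cast
    rfl
  have hqC : (q : ℂ) ≠ 0 := by exact_mod_cast hq0.ne'
  simp only [habs, hsqrt, ← hcast, Complex.real_smul]
  push_cast
  simp only [div_eq_mul_inv, mul_inv, one_mul]
  field_simp

/-- The Stieltjes transform of the Marchenko–Pastur law satisfies the
self-consistent equation in the upper half plane. -/
theorem mp_stieltjes_self_consistent
    (y : ℝ) (hy0 : 0 < y) (hy1 : y ≤ 1) (z : ℂ) (hz : 0 < z.im) :
    mpStieltjes y z +
      1 / ((y : ℂ) + z - 1 + (y : ℂ) * z * mpStieltjes y z) = 0 := by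
  have hq0 : 0 < √y := Real.sqrt_pos.mpr hy0
  have hq1 : √y ≤ 1 := Real.sqrt_le_one.mpr hy1
  have hqy : (y : ℂ) = (√y : ℂ) ^ 2 := by exact_mod_cast (Real.sq_sqrt hy0.le).symm
  rw [mpStieltjes_eq_integral_sin_sq hy0, hqy]
  set q := √y
  have hqC : (q : ℂ) ≠ 0 := by exact_mod_cast hq0.ne'
  have hpi : (Real.pi : ℂ) ≠ 0 := by exact_mod_cast Real.pi_ne_zero
  have hz0 : z ≠ 0 := fun h => by simp [h] at hz
  obtain ⟨w, hw0, hw1, hw⟩ := exists_norm_lt_one_add_inv_eq (u := (z - 1 - q ^ 2) / q) (by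
    have : ((z - 1 - q ^ 2) / q : ℂ).im = z.im / q := by
      rw [Complex.div_ofReal_im]
      simp [← Complex.ofReal_pow]
    rw [this]
    exact (div_pos hz hq0).ne')
  have hzw : z = (1 + q * w) * (1 + q / w) := by
    rw [eq_div_iff hqC] at hw
    have : z = 1 + q ^ 2 + (w + w⁻¹) * q := by rw [hw]; ring
    rw [this]
    field_simp
    ring
  have hfac : ∀ θ : ℝ, 1 + 2 * q * (Real.cos θ : ℂ) + (q : ℂ) ^ 2 - z =
      -(q / w) * (1 - 2 * w * (Real.cos θ : ℂ) + w ^ 2) := fun θ => by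
    rw [hzw]
    field_simp
    ring
  have hI₁ : ∫ θ in (0 : ℝ)..Real.pi, (Real.sin θ : ℂ) ^ 2 /
      (1 + 2 * q * (Real.cos θ : ℂ) + (q : ℂ) ^ 2 - z) = -(w / q) * (Real.pi / 2) := by
    rw [← integral_sin_sq_div_kernel hw1, ← intervalIntegral.integral_const_mul]
    refine intervalIntegral.integral_congr fun θ _ => ?_
    simp only [hfac, div_eq_mul_inv, mul_inv, inv_neg, inv_inv]
    ring
  have hI₀ := integral_sin_sq_div_one_add_sq hq0 hq1
  have hsplit : ∀ θ : ℝ, 2 / Real.pi *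
      ((Real.sin θ : ℂ) ^ 2 / ((1 + 2 * q * (Real.cos θ : ℂ) + (q : ℂ) ^ 2) *
        (1 + 2 * q * (Real.cos θ : ℂ) + (q : ℂ) ^ 2 - z))) =
      2 / (Real.pi * z) *
        ((Real.sin θ : ℂ) ^ 2 / (1 + 2 * q * (Real.cos θ : ℂ) + (q : ℂ) ^ 2 - z) -
        (Real.sin θ : ℂ) ^ 2 / (1 + 2 * q * (Real.cos θ : ℂ) + (q : ℂ) ^ 2)) := fun θ => by
    rcases eq_or_ne (Real.sin θ) 0 with h | h
    · simp [h]
    have hx : (1 + 2 * q * (Real.cos θ : ℂ) + (q : ℂ) ^ 2) ≠ 0 := by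
      norm_cast
      have := Real.sin_sq_add_cos_sq θ
      have : 0 < Real.sin θ ^ 2 := by positivity
      nlinarith [sq_nonneg (q + Real.cos θ)]
    have hxz : (1 + 2 * q * (Real.cos θ : ℂ) + (q : ℂ) ^ 2) - z ≠ 0 := fun h => by
      rw [← sub_eq_zero.mp h] at hz
      norm_cast at hz
    generalize (1 + 2 * q * (Real.cos θ : ℂ) + (q : ℂ) ^ 2) = x at hx hxz
    field_simp
    ring
  simp only [hsplit]
  rw [intervalIntegral.integral_const_mul, intervalIntegral.integral_sub
    (intervalIntegral.intervalIntegrable_of_integral_ne_zero (by rw [hI₁]; simp [hw0, hqC, hpi]))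
    (intervalIntegral.intervalIntegrable_of_integral_ne_zero (by rw [hI₀]; simp [hpi])),
    hI₁, hI₀]
  have hA : 1 + (q : ℂ) * w ≠ 0 := fun h => hz0 (by rw [hzw, h, zero_mul])
  have hB : w + (q : ℂ) ≠ 0 := fun h => hz0 (by
    rw [hzw, show 1 + (q : ℂ) / w = (w + q) / w by field_simp, h]; simp)
  have hs : 2 / (Real.pi * z) * (-(w / q) * (Real.pi / 2) - Real.pi / 2) =
      -w / (q * (1 + q * w)) := by
    rw [hzw, show 1 + (q : ℂ) / w = (w + q) / w by field_simp]
    field_simp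
    ring
  have hden : (q : ℂ) ^ 2 + z - 1 + q ^ 2 * z * (-w / (q * (1 + q * w))) =
      q * (1 + q * w) / w := by
    rw [hzw]
    field_simp
    ring
  rw [hs, hden]
  field_simp
  ring
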